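/- Let (f,g) be a slice trajectory on a closed interval I. For real x set T_x = inf{t ∈ I : f(t) = −x}. Let L < L' < L'' be reals with L ≥ −f(inf I) if inf I > −∞ and L'' ≤ −inf_I f, and such that T_L and T_{L''} are finite. Set J₁ = [T_L, T_{L'}], J₂ = [T_{L'}, T_{L''}], J = [T_L, T_{L''}], and let D₁ = D_{f|J₁,g|J₁}, D₂ = D_{f|J₂,g|J₂}, D = D_{f|J,g|J}. Set ℓ = g(T_{L'}) − max(inf_{J₁} g, inf_{J₂} g), and for 0 ≤ r ≤ ℓ put Ξ(r) = sup{s ∈ J₁ : g(s) = g(T_{L'}) − r} and Γ(r) = inf{s ∈ J₂ : g(s) = g(T_{L'}) − r}. Then: (a) D(s,t) = D₁(s,t) for all s, t ∈ J₁; (b) D(s,t) = D₂(s,t) for all s, t ∈ J₂; (c) for all s ∈ J₁ and t ∈ J₂, D(s,t) = inf{ D₁(s,Ξ(r)) + D₂(Γ(r),t) : 0 ≤ r ≤ ℓ }. That is, the slice coded by (f,g) between levels L and L'' is the metric gluing of the slice between levels L and L' and the slice between levels L' and L'', the shuttle of the first being glued to the maximal geodesic of the second. -/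

import Mathlib

open scoped ENNReal

/-- The tree pseudometric `d_f(s,t) = f(s) + f(t) − 2·inf{f(u) : s∧t ≤ u ≤ s∨t}`. -/
noncomputable def dOf (f : ℝ → ℝ) (s t : ℝ) : ℝ :=
  f s + f t - 2 * sInf (f '' Set.Icc (min s t) (max s t))

/-- The quotient pseudometric `d/R`, with chain points constrained to lie in `S`. -/
noncomputable def quotDistOn {α : Type*} (d : α → α → ℝ≥0∞) (R : α → α → Prop)
    (S : Set α) (x y : α) : ℝ≥0∞ :=
  ⨅ (n : ℕ) (a : Fin (n + 1) → α) (b : Fin (n + 1) → α)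
    (_ : ∀ i, a i ∈ S) (_ : ∀ i, b i ∈ S)
    (_ : a 0 = x) (_ : b (Fin.last n) = y)
    (_ : ∀ i : Fin n, R (b i.castSucc) (a i.succ)),
    ∑ i, d (a i) (b i)

/-- The quotient pseudometric `D_{f,g} = d_g / {d_f = 0}` on the set `J`. -/
noncomputable def Dquot (f g : ℝ → ℝ) (J : Set ℝ) : ℝ → ℝ → ℝ≥0∞ :=
  quotDistOn (fun s t => ENNReal.ofReal (dOf g s t)) (fun s t => dOf f s t = 0) J

/-- A slice trajectory. -/
def IsSliceTrajectory (I : Set ℝ) (f g : ℝ → ℝ) : Prop :=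
  IsClosed I ∧ I.OrdConnected ∧ I.Nonempty ∧
  ContinuousOn f I ∧ ContinuousOn g I ∧
  (∀ s ∈ I, ∀ t ∈ I, dOf f s t = 0 → g s = g t) ∧
  (¬ BddBelow I →
    Filter.Tendsto f (Filter.atBot ⊓ Filter.principal I) Filter.atTop ∧
    ¬ BddBelow (g '' (I ∩ Set.Iic 0))) ∧
  (¬ BddAbove I →
    ¬ BddBelow (f '' (I ∩ Set.Ici 0)) ∧ ¬ BddBelow (g '' (I ∩ Set.Ici 0)))

/-- `T_x = inf{t ∈ I : f(t) = −x}`. -/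
noncomputable def hitT (I : Set ℝ) (f : ℝ → ℝ) (x : ℝ) : ℝ :=
  sInf {t | t ∈ I ∧ f t = -x}

section QuotientPseudometric

variable {α : Type*} {d : α → α → ℝ≥0∞} {R : α → α → Prop} {S : Set α}

theorem quotDistOn_le {x y : α} (hx : x ∈ S) (hy : y ∈ S) : quotDistOn d R S x y ≤ d x y := by
  unfold quotDistOn
  refine iInf_le_of_le 0 <| iInf_le_of_le (fun _ => x) <| iInf_le_of_le (fun _ => y) <|
    iInf_le_of_le (fun _ => hx) <| iInf_le_of_le (fun _ => hy) <| iInf_le_of_le rfl <|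
    iInf_le_of_le rfl <| iInf_le_of_le (fun i => i.elim0) ?_
  simp

theorem quotDistOn_self (hd : ∀ x, d x x = 0) {x : α} (hx : x ∈ S) :
    quotDistOn d R S x x = 0 :=
  le_antisymm ((quotDistOn_le hx hx).trans_eq (hd x)) bot_le

theorem quotDistOn_anti {S' : Set α} (hS : S ⊆ S') (x y : α) :
    quotDistOn d R S' x y ≤ quotDistOn d R S x y := by
  unfold quotDistOn
  gcongr with n a b
  refine le_iInf fun ha => le_iInf fun hb => ?_
  exact iInf_le_of_le (fun i => hS (ha i)) (iInf_le_of_le (fun i => hS (hb i)) le_rfl)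

/-- A potential that grows at most by `d` along steps and does not grow along `R` is a lower
bound for the quotient pseudometric. -/
theorem le_quotDistOn (F : α → ℝ≥0∞) {s : α} (hs : F s = 0)
    (hd : ∀ x ∈ S, ∀ y ∈ S, F y ≤ F x + d x y)
    (hR : ∀ x ∈ S, ∀ y ∈ S, R x y → F y ≤ F x) (t : α) :
    F t ≤ quotDistOn d R S s t := by
  have key : ∀ (n : ℕ) (a b : Fin (n + 1) → α), (∀ i, a i ∈ S) → (∀ i, b i ∈ S) →
      (∀ i : Fin n, R (b i.castSucc) (a i.succ)) →
      F (b (Fin.last n)) ≤ F (a 0) + ∑ i, d (a i) (b i) := by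
    intro n
    induction n with
    | zero =>
      intro a b ha hb _
      simpa using hd _ (ha 0) _ (hb 0)
    | succ n ih =>
      intro a b ha hb hab
      have h1 := ih (fun i => a i.castSucc) (fun i => b i.castSucc) (fun i => ha _)
        (fun i => hb _) (fun i => by simpa using hab i.castSucc)
      have h2 := hR _ (hb _) _ (ha _) (hab (Fin.last n))
      have h3 := hd _ (ha (Fin.last (n + 1))) _ (hb (Fin.last (n + 1)))
      rw [Fin.sum_univ_castSucc, ← add_assoc]
      refine h3.trans ?_
      gcongr
      exact h2.trans (by simpa using h1)
  unfold quotDistOn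
  refine le_iInf fun n => le_iInf fun a => le_iInf fun b => le_iInf fun ha => le_iInf fun hb =>
    le_iInf fun h0 => le_iInf fun h1 => le_iInf fun hab => ?_
  have := key n a b ha hb hab
  rwa [h0, h1, hs, zero_add] at this

theorem quotDistOn_append {s x x' y : α} (hx : x ∈ S) (hy : y ∈ S) (hR : R x' x) :
    quotDistOn d R S s y ≤ quotDistOn d R S s x' + d x y := by
  conv_rhs => unfold quotDistOn
  simp only [ENNReal.iInf_add]
  refine le_iInf fun n => le_iInf fun a => le_iInf fun b => le_iInf fun ha => le_iInf fun hb =>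
    le_iInf fun h0 => le_iInf fun h1 => le_iInf fun hab => ?_
  unfold quotDistOn
  refine iInf_le_of_le (n + 1) <| iInf_le_of_le (Fin.snoc (α := fun _ => α) a x) <|
    iInf_le_of_le (Fin.snoc (α := fun _ => α) b y) <|
    iInf_le_of_le ?_ <| iInf_le_of_le ?_ <| iInf_le_of_le ?_ <|
    iInf_le_of_le (by simp) <| iInf_le_of_le ?_ ?_
  · intro i
    refine Fin.lastCases ?_ (fun i => ?_) i <;> simp [hx, ha]
  · intro i
    refine Fin.lastCases ?_ (fun i => ?_) i <;> simp [hy, hb]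
  · rw [← h0]
    exact Fin.snoc_castSucc (α := fun _ => α) x a 0
  · intro i
    refine Fin.lastCases ?_ (fun i => ?_) i
    · simpa [h1] using hR
    · simp only [Fin.succ_castSucc, Fin.snoc_castSucc]
      exact hab i
  · rw [Fin.sum_univ_castSucc]
    simp

theorem quotDistOn_le_of_rel (hd : ∀ x, d x x = 0) {s x y : α} (hy : y ∈ S) (hR : R x y) :
    quotDistOn d R S s y ≤ quotDistOn d R S s x := by
  simpa [hd] using quotDistOn_append (d := d) (s := s) hy hy hR

theorem quotDistOn_eq_zero_of_rel (hd : ∀ x, d x x = 0) {x y : α} (hx : x ∈ S) (hy : y ∈ S)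
    (hR : R x y) : quotDistOn d R S x y = 0 :=
  le_antisymm ((quotDistOn_le_of_rel hd hy hR).trans_eq (quotDistOn_self hd hx)) bot_le

theorem quotDistOn_triangle (hd : ∀ x, d x x = 0) (hR : ∀ x, R x x) (s u t : α) :
    quotDistOn d R S s t ≤ quotDistOn d R S s u + quotDistOn d R S u t := by
  rw [add_comm, ← tsub_le_iff_right]
  refine le_quotDistOn (fun t => quotDistOn d R S s t - quotDistOn d R S s u) (tsub_self _)
    (fun x hx y hy => ?_) (fun x hx y hy hxy => ?_) t
  · rw [tsub_le_iff_right, add_right_comm]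
    refine (quotDistOn_append hx hy (hR x)).trans ?_
    gcongr
    exact le_tsub_add
  · exact tsub_le_tsub_right (quotDistOn_le_of_rel hd hy hxy) _

theorem quotDistOn_comm_le (hd : ∀ x, d x x = 0) (hds : ∀ x y, d x y = d y x)
    (hR : ∀ x, R x x) (hRs : ∀ x y, R x y → R y x) {s : α} (hs : s ∈ S) (t : α) :
    quotDistOn d R S t s ≤ quotDistOn d R S s t := by
  refine le_quotDistOn (fun t => quotDistOn d R S t s) (quotDistOn_self hd hs)
    (fun x hx y hy => ?_) (fun x hx y hy hxy => ?_) t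
  · refine (quotDistOn_triangle hd hR y x s).trans ?_
    rw [add_comm, hds x y]
    gcongr
    exact quotDistOn_le hy hx
  · refine (quotDistOn_triangle hd hR y x s).trans ?_
    rw [quotDistOn_eq_zero_of_rel hd hy hx (hRs _ _ hxy), zero_add]

theorem quotDistOn_comm (hd : ∀ x, d x x = 0) (hds : ∀ x y, d x y = d y x)
    (hR : ∀ x, R x x) (hRs : ∀ x y, R x y → R y x) {s t : α} (hs : s ∈ S) (ht : t ∈ S) :
    quotDistOn d R S s t = quotDistOn d R S t s :=
  le_antisymm (quotDistOn_comm_le hd hds hR hRs ht s) (quotDistOn_comm_le hd hds hR hRs hs t)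

/-- If every step and every identification between `A` and `B` passes through a seam along
which `ξ` and `γ` are isometric, then the quotient pseudometric on `A ∪ B` dominates the gluing
of those on `A` and `B`, seen from a point of `A`. -/
theorem le_quotDistOn_union {κ : Type*} {K : Set κ} {A B : Set α} {ξ γ : κ → α}
    (hd : ∀ x, d x x = 0) (hds : ∀ x y, d x y = d y x)
    (hR : ∀ x, R x x) (hRs : ∀ x y, R x y → R y x)
    (hξ : ∀ r ∈ K, ξ r ∈ A) (hγ : ∀ r ∈ K, γ r ∈ B)
    (hiso : ∀ r ∈ K, ∀ r' ∈ K,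
      quotDistOn d R A (ξ r) (ξ r') ≤ quotDistOn d R B (γ r) (γ r'))
    (hcross : ∀ x ∈ A, ∀ y ∈ B, ∃ r ∈ K, d x (ξ r) + d (γ r) y ≤ d x y)
    (hrel : ∀ x ∈ A, ∀ y ∈ B, R x y → ∃ r ∈ K,
      quotDistOn d R A x (ξ r) = 0 ∧ quotDistOn d R B (γ r) y = 0)
    {s : α} (hs : s ∈ A) (t : α) :
    (t ∈ A → quotDistOn d R A s t ≤ quotDistOn d R (A ∪ B) s t) ∧
    (t ∈ B → ⨅ r ∈ K, (quotDistOn d R A s (ξ r) + quotDistOn d R B (γ r) t) ≤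
      quotDistOn d R (A ∪ B) s t) := by
  set F : α → ℝ≥0∞ := fun t => max (⨆ _ : t ∈ A, quotDistOn d R A s t)
    (⨆ _ : t ∈ B, ⨅ r ∈ K, (quotDistOn d R A s (ξ r) + quotDistOn d R B (γ r) t))
  have F_le : ∀ {y z}, (y ∈ A → quotDistOn d R A s y ≤ z) →
      (y ∈ B → ∃ r ∈ K, quotDistOn d R A s (ξ r) + quotDistOn d R B (γ r) y ≤ z) →
      F y ≤ z := by
    intro y z h1 h2
    refine max_le (iSup_le h1) (iSup_le fun hy => ?_)
    obtain ⟨r, hr, h⟩ := h2 hy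
    exact (iInf₂_le r hr).trans h
  have le_FA : ∀ {y}, y ∈ A → quotDistOn d R A s y ≤ F y := fun {y} hy =>
    le_max_of_le_left (le_iSup (fun _ : y ∈ A => quotDistOn d R A s y) hy)
  have le_FB : ∀ {y}, y ∈ B →
      ⨅ r ∈ K, (quotDistOn d R A s (ξ r) + quotDistOn d R B (γ r) y) ≤ F y := fun {y} hy =>
    le_max_of_le_right (le_iSup (fun _ : y ∈ B =>
      ⨅ r ∈ K, (quotDistOn d R A s (ξ r) + quotDistOn d R B (γ r) y)) hy)
  have F_B : ∀ {y z e}, y ∈ B →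
      (∀ r ∈ K, z ≤ quotDistOn d R A s (ξ r) + quotDistOn d R B (γ r) y + e) →
      z ≤ F y + e := by
    intro y z e hy h1
    refine le_trans ?_ (add_le_add_left (le_FB hy) e)
    simp only [ENNReal.iInf_add]
    exact le_iInf₂ h1
  have triA := fun u v w => quotDistOn_triangle (S := A) hd hR u v w
  have triB := fun u v w => quotDistOn_triangle (S := B) hd hR u v w
  have step : ∀ x ∈ A ∪ B, ∀ y ∈ A ∪ B, ∀ e : ℝ≥0∞,
      (x ∈ A → y ∈ A → quotDistOn d R A x y ≤ e) →
      (x ∈ B → y ∈ B → quotDistOn d R B x y ≤ e) →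
      (x ∈ A → y ∈ B → ∃ r ∈ K, quotDistOn d R A x (ξ r) + quotDistOn d R B (γ r) y ≤ e) →
      (y ∈ A → x ∈ B → ∃ r ∈ K, quotDistOn d R A y (ξ r) + quotDistOn d R B (γ r) x ≤ e) →
      F y ≤ F x + e := by
    intro x hx y hy e hAA hBB hAB hBA
    rcases hx with hx | hx
    · refine F_le (fun hy => ?_) (fun hy => ?_)
      · exact (triA s x y).trans (add_le_add (le_FA hx) (hAA hx hy))
      · obtain ⟨r, hr, h⟩ := hAB hx hy
        refine ⟨r, hr, ?_⟩
        calc quotDistOn d R A s (ξ r) + quotDistOn d R B (γ r) y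
            ≤ quotDistOn d R A s x + quotDistOn d R A x (ξ r) + quotDistOn d R B (γ r) y := by
              gcongr; exact triA _ _ _
          _ ≤ F x + e := by
              rw [add_assoc]; exact add_le_add (le_FA hx) h
    · refine F_B hx fun r' hr' => F_le (fun hy => ?_) (fun hy => ⟨r', hr', ?_⟩)
      · obtain ⟨r, hr, h⟩ := hBA hy hx
        calc quotDistOn d R A s y
            ≤ quotDistOn d R A s (ξ r') +
                (quotDistOn d R A (ξ r') (ξ r) + quotDistOn d R A (ξ r) y) :=
              (triA _ (ξ r') _).trans (by gcongr; exact triA _ _ _)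
          _ ≤ quotDistOn d R A s (ξ r') +
                (quotDistOn d R B (γ r') x + quotDistOn d R B x (γ r)
                  + quotDistOn d R A (ξ r) y) := by
              gcongr; exact (hiso r' hr' r hr).trans (triB _ _ _)
          _ = quotDistOn d R A s (ξ r') + quotDistOn d R B (γ r') x +
                (quotDistOn d R A y (ξ r) + quotDistOn d R B (γ r) x) := by
              rw [quotDistOn_comm hd hds hR hRs hx (hγ r hr),
                quotDistOn_comm hd hds hR hRs (hξ r hr) hy]
              ring
          _ ≤ _ := by gcongr
      · calc _ ≤ quotDistOn d R A s (ξ r') +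
              (quotDistOn d R B (γ r') x + quotDistOn d R B x y) := by
              gcongr; exact triB _ _ _
          _ ≤ _ := by rw [← add_assoc]; gcongr; exact hBB hx hy
  have main : F t ≤ quotDistOn d R (A ∪ B) s t := by
    refine le_quotDistOn F ?_ (fun x hx y hy => ?_) (fun x hx y hy hxy => ?_) t
    · refine le_antisymm (F_le (fun _ => (quotDistOn_self hd hs).le) fun hsB => ?_) bot_le
      obtain ⟨r, hr, h1, h2⟩ := hrel s hs s hsB (hR s)
      exact ⟨r, hr, by simp [h1, h2]⟩
    · refine step x hx y hy _ quotDistOn_le quotDistOn_le (fun hx hy => ?_) (fun hy hx => ?_)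
      · obtain ⟨r, hr, h⟩ := hcross x hx y hy
        exact ⟨r, hr, (add_le_add (quotDistOn_le hx (hξ r hr))
          (quotDistOn_le (hγ r hr) hy)).trans h⟩
      · obtain ⟨r, hr, h⟩ := hcross y hy x hx
        exact ⟨r, hr, (add_le_add (quotDistOn_le hy (hξ r hr))
          (quotDistOn_le (hγ r hr) hx)).trans (h.trans_eq (hds _ _))⟩
    · rw [← add_zero (F x)]
      refine step x hx y hy 0
        (fun hx hy => (quotDistOn_eq_zero_of_rel hd hx hy hxy).le)
        (fun hx hy => (quotDistOn_eq_zero_of_rel hd hx hy hxy).le)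
        (fun hx hy => ?_) (fun hy hx => ?_)
      · obtain ⟨r, hr, h1, h2⟩ := hrel x hx y hy hxy
        exact ⟨r, hr, by simp [h1, h2]⟩
      · obtain ⟨r, hr, h1, h2⟩ := hrel y hy x hx (hRs _ _ hxy)
        exact ⟨r, hr, by simp [h1, h2]⟩
  exact ⟨fun ht => (le_FA ht).trans main, fun ht => (le_FB ht).trans main⟩

end QuotientPseudometric

section TreePseudometric

variable {g : ℝ → ℝ} {a b c : ℝ}

theorem dOf_self (f : ℝ → ℝ) (s : ℝ) : dOf f s s = 0 := by
  simp [dOf]; ring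

theorem dOf_comm (f : ℝ → ℝ) (s t : ℝ) : dOf f s t = dOf f t s := by
  simp [dOf, min_comm, max_comm, add_comm]

theorem dOf_le_of_forall_le {k s t : ℝ} (h : ∀ u ∈ Set.Icc (min s t) (max s t), k ≤ g u) :
    dOf g s t ≤ g s + g t - 2 * k := by
  have : k ≤ sInf (g '' Set.Icc (min s t) (max s t)) := by
    refine le_csInf ((Set.nonempty_Icc.2 min_le_max).image g) ?_
    rintro _ ⟨u, hu, rfl⟩
    exact h u hu
  unfold dOf
  linarith

theorem sInf_image_Icc_le (hg : ContinuousOn g (Set.Icc a b)) {u : ℝ} (hu : u ∈ Set.Icc a b) :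
    sInf (g '' Set.Icc a b) ≤ g u :=
  csInf_le (isCompact_Icc.image_of_continuousOn hg).bddBelow ⟨u, hu, rfl⟩

theorem sInf_image_le_of_mem (hg : ContinuousOn g (Set.Icc a b)) {s t u : ℝ}
    (hs : s ∈ Set.Icc a b) (ht : t ∈ Set.Icc a b) (hu : u ∈ Set.Icc (min s t) (max s t)) :
    sInf (g '' Set.Icc (min s t) (max s t)) ≤ g u :=
  sInf_image_Icc_le (hg.mono (Set.Icc_subset_Icc (le_min hs.1 ht.1) (max_le hs.2 ht.2))) hu

theorem abs_sub_le_dOf (hg : ContinuousOn g (Set.Icc a b)) {s t : ℝ}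
    (hs : s ∈ Set.Icc a b) (ht : t ∈ Set.Icc a b) : |g s - g t| ≤ dOf g s t := by
  have h1 := sInf_image_le_of_mem hg hs ht (u := s) ⟨min_le_left _ _, le_max_left _ _⟩
  have h2 := sInf_image_le_of_mem hg hs ht (u := t) ⟨min_le_right _ _, le_max_right _ _⟩
  unfold dOf
  rw [abs_le]
  constructor <;> linarith

theorem ofReal_abs_sub_le_Dquot {f : ℝ → ℝ} (hg : ContinuousOn g (Set.Icc a b))
    (hfg : ∀ s ∈ Set.Icc a b, ∀ t ∈ Set.Icc a b, dOf f s t = 0 → g s = g t)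
    {s : ℝ} (t : ℝ) :
    ENNReal.ofReal |g s - g t| ≤ Dquot f g (Set.Icc a b) s t := by
  refine le_quotDistOn (fun t => ENNReal.ofReal |g s - g t|) (by simp)
    (fun x hx y hy => ?_) (fun x hx y hy hxy => ?_) t
  · rw [← ENNReal.ofReal_add (abs_nonneg _) ((abs_nonneg _).trans (abs_sub_le_dOf hg hx hy))]
    refine ENNReal.ofReal_le_ofReal ?_
    have h1 := abs_sub_le_dOf hg hx hy
    have h2 := abs_sub_le (g s) (g x) (g y)
    linarith
  · simp only [hfg x hx y hy hxy, le_refl]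

theorem sSup_level_spec (hac : a ≤ c) (hg : ContinuousOn g (Set.Icc a c)) {v : ℝ}
    (hv : sInf (g '' Set.Icc a c) ≤ v) (hvc : v ≤ g c) :
    sSup {u | u ∈ Set.Icc a c ∧ g u = v} ∈ Set.Icc a c ∧
    g (sSup {u | u ∈ Set.Icc a c ∧ g u = v}) = v ∧
    ∀ u ∈ Set.Icc (sSup {u | u ∈ Set.Icc a c ∧ g u = v}) c, v ≤ g u := by
  set X := {u | u ∈ Set.Icc a c ∧ g u = v}
  have hbdd : BddAbove X := ⟨c, fun u hu => hu.1.2⟩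
  have ivt : ∀ w ∈ Set.Icc a c, g w ≤ v → ∃ u ∈ X, w ≤ u := by
    intro w hw hgw
    obtain ⟨u, hu, rfl⟩ := intermediate_value_Icc hw.2
      (hg.mono (Set.Icc_subset_Icc_left hw.1)) ⟨hgw, hvc⟩
    exact ⟨u, ⟨⟨hw.1.trans hu.1, hu.2⟩, rfl⟩, hu.1⟩
  have hne : X.Nonempty := by
    obtain ⟨w, hw, hwm⟩ := isCompact_Icc.exists_sInf_image_eq (Set.nonempty_Icc.2 hac) hg
    obtain ⟨u, hu, _⟩ := ivt w hw (hwm ▸ hv)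
    exact ⟨u, hu⟩
  have hcl : IsClosed X := hg.preimage_isClosed_of_isClosed isClosed_Icc isClosed_singleton
  have hmem := hcl.csSup_mem hne hbdd
  refine ⟨hmem.1, hmem.2, fun u hu => ?_⟩
  by_contra! hlt
  obtain ⟨w, hw, huw⟩ := ivt u ⟨hmem.1.1.trans hu.1, hu.2⟩ hlt.le
  have h1 := le_csSup hbdd hw
  have h2 : u = w := le_antisymm huw (h1.trans hu.1)
  rw [h2, hw.2] at hlt
  exact lt_irrefl _ hlt

theorem sInf_level_spec (hcb : c ≤ b) (hg : ContinuousOn g (Set.Icc c b)) {v : ℝ}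
    (hv : sInf (g '' Set.Icc c b) ≤ v) (hvc : v ≤ g c) :
    sInf {u | u ∈ Set.Icc c b ∧ g u = v} ∈ Set.Icc c b ∧
    g (sInf {u | u ∈ Set.Icc c b ∧ g u = v}) = v ∧
    ∀ u ∈ Set.Icc c (sInf {u | u ∈ Set.Icc c b ∧ g u = v}), v ≤ g u := by
  set X := {u | u ∈ Set.Icc c b ∧ g u = v}
  have hbdd : BddBelow X := ⟨c, fun u hu => hu.1.1⟩
  have ivt : ∀ w ∈ Set.Icc c b, g w ≤ v → ∃ u ∈ X, u ≤ w := by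
    intro w hw hgw
    obtain ⟨u, hu, rfl⟩ := intermediate_value_Icc' hw.1
      (hg.mono (Set.Icc_subset_Icc_right hw.2)) ⟨hgw, hvc⟩
    exact ⟨u, ⟨⟨hu.1, hu.2.trans hw.2⟩, rfl⟩, hu.2⟩
  have hne : X.Nonempty := by
    obtain ⟨w, hw, hwm⟩ := isCompact_Icc.exists_sInf_image_eq (Set.nonempty_Icc.2 hcb) hg
    obtain ⟨u, hu, _⟩ := ivt w hw (hwm ▸ hv)
    exact ⟨u, hu⟩
  have hcl : IsClosed X := hg.preimage_isClosed_of_isClosed isClosed_Icc isClosed_singleton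
  have hmem := hcl.csInf_mem hne hbdd
  refine ⟨hmem.1, hmem.2, fun u hu => ?_⟩
  by_contra! hlt
  obtain ⟨w, hw, huw⟩ := ivt u ⟨hu.1, hu.2.trans hmem.1.2⟩ hlt.le
  have h1 := csInf_le hbdd hw
  have h2 : u = w := le_antisymm (hu.2.trans h1) huw
  rw [h2, hw.2] at hlt
  exact lt_irrefl _ hlt

end TreePseudometric

theorem hitT_spec {I : Set ℝ} {f g : ℝ → ℝ} (h : IsSliceTrajectory I f g) {x : ℝ}
    (hlow : BddBelow I → -f (sInf I) ≤ x) (hne : {t | t ∈ I ∧ f t = -x}.Nonempty) :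
    hitT I f x ∈ I ∧ f (hitT I f x) = -x ∧ ∀ t ∈ I, t < hitT I f x → -x < f t := by
  obtain ⟨hcl, hord, hIne, hf, -, -, hbot, -⟩ := h
  have far : ¬ BddBelow I → ∃ N, ∀ t ∈ I, t ≤ N → -x < f t := by
    intro hb
    have h1 := (hbot hb).1.eventually_gt_atTop (-x)
    rw [Filter.eventually_inf_principal, Filter.eventually_atBot] at h1
    obtain ⟨N, hN⟩ := h1
    exact ⟨N, fun t ht htN => hN t htN ht⟩
  have hbdd : BddBelow {t | t ∈ I ∧ f t = -x} := by
    by_cases hb : BddBelow I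
    · exact hb.mono fun t ht => ht.1
    · obtain ⟨N, hN⟩ := far hb
      refine ⟨N, fun t ht => ?_⟩
      by_contra! hlt
      exact (hN t ht.1 hlt.le).ne' ht.2
  have hmem := (hf.preimage_isClosed_of_isClosed hcl (isClosed_singleton (x := -x))).csInf_mem
    hne hbdd
  refine ⟨hmem.1, hmem.2, fun t ht hlt => ?_⟩
  by_contra! hle
  have start : ∃ p ∈ I, p ≤ t ∧ -x ≤ f p := by
    by_cases hb : BddBelow I
    · exact ⟨sInf I, hcl.csInf_mem hIne hb, csInf_le hb ht, by linarith [hlow hb]⟩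
    · obtain ⟨N, hN⟩ := far hb
      obtain ⟨p, hp, hpN⟩ := not_bddBelow_iff.1 hb (min N t)
      exact ⟨p, hp, hpN.le.trans (min_le_right _ _),
        (hN p hp (hpN.le.trans (min_le_left _ _))).le⟩
  obtain ⟨p, hp, hpt, hfp⟩ := start
  obtain ⟨u, hu, hfu⟩ := intermediate_value_Icc' hpt (hf.mono (hord.out hp ht)) ⟨hle, hfp⟩
  exact (csInf_le hbdd ⟨hord.out hp ht hu, hfu⟩).not_gt (hu.2.trans_lt hlt)

/-- A point `c` before which `f` stays strictly above `f c` splits the quotient pseudometric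
coded by `(f, g)` as a gluing along the shuttle and the maximal geodesic issued from `c`. -/
theorem Dquot_gluing {f g : ℝ → ℝ} {a b c : ℝ} (hac : a ≤ c) (hcb : c ≤ b)
    (hf : ContinuousOn f (Set.Icc a b)) (hg : ContinuousOn g (Set.Icc a b))
    (hfg : ∀ s ∈ Set.Icc a b, ∀ t ∈ Set.Icc a b, dOf f s t = 0 → g s = g t)
    (hfc : ∀ t ∈ Set.Icc a b, t < c → f c < f t) :
    (∀ s ∈ Set.Icc a c, ∀ t ∈ Set.Icc a c,
      Dquot f g (Set.Icc a b) s t = Dquot f g (Set.Icc a c) s t) ∧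
    (∀ s ∈ Set.Icc c b, ∀ t ∈ Set.Icc c b,
      Dquot f g (Set.Icc a b) s t = Dquot f g (Set.Icc c b) s t) ∧
    (∀ s ∈ Set.Icc a c, ∀ t ∈ Set.Icc c b,
      Dquot f g (Set.Icc a b) s t =
        ⨅ r ∈ Set.Icc (0:ℝ) (g c -
          max (sInf (g '' Set.Icc a c)) (sInf (g '' Set.Icc c b))),
          (Dquot f g (Set.Icc a c) s (sSup {u | u ∈ Set.Icc a c ∧ g u = g c - r}) +
           Dquot f g (Set.Icc c b) (sInf {u | u ∈ Set.Icc c b ∧ g u = g c - r}) t)) := by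
  have hA : Set.Icc a c ⊆ Set.Icc a b := Set.Icc_subset_Icc_right hcb
  have hB : Set.Icc c b ⊆ Set.Icc a b := Set.Icc_subset_Icc_left hac
  have hgA := hg.mono hA
  have hgB := hg.mono hB
  set m₁ := sInf (g '' Set.Icc a c)
  set m₂ := sInf (g '' Set.Icc c b)
  set ξ : ℝ → ℝ := fun r => sSup {u | u ∈ Set.Icc a c ∧ g u = g c - r}
  set γ : ℝ → ℝ := fun r => sInf {u | u ∈ Set.Icc c b ∧ g u = g c - r}
  set K := Set.Icc (0:ℝ) (g c - max m₁ m₂)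
  have hξ : ∀ r ∈ K, ξ r ∈ Set.Icc a c ∧ g (ξ r) = g c - r ∧
      ∀ u ∈ Set.Icc (ξ r) c, g c - r ≤ g u := fun r hr =>
    sSup_level_spec hac hgA (by linarith [hr.2, le_max_left m₁ m₂]) (by linarith [hr.1])
  have hγ : ∀ r ∈ K, γ r ∈ Set.Icc c b ∧ g (γ r) = g c - r ∧
      ∀ u ∈ Set.Icc c (γ r), g c - r ≤ g u := fun r hr =>
    sInf_level_spec hcb hgB (by linarith [hr.2, le_max_right m₁ m₂]) (by linarith [hr.1])
  have hm₁le : ∀ u ∈ Set.Icc a c, m₁ ≤ g u := fun u hu => sInf_image_Icc_le hgA hu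
  have hm₂le : ∀ u ∈ Set.Icc c b, m₂ ≤ g u := fun u hu => sInf_image_Icc_le hgB hu
  have h0K : (0:ℝ) ∈ K := ⟨le_rfl, sub_nonneg.2 <|
    max_le (hm₁le c ⟨hac, le_rfl⟩) (hm₂le c ⟨le_rfl, hcb⟩)⟩
  set d : ℝ → ℝ → ℝ≥0∞ := fun s t => ENNReal.ofReal (dOf g s t) with hddef
  set R : ℝ → ℝ → Prop := fun s t => dOf f s t = 0 with hRdef
  have hd : ∀ x, d x x = 0 := fun x => by simp [hddef, dOf_self]
  have hds : ∀ x y, d x y = d y x := fun x y => by simp only [hddef, dOf_comm g x y]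
  have hR : ∀ x, R x x := dOf_self f
  have hRs : ∀ x y, R x y → R y x := fun x y hxy => (dOf_comm f y x).trans hxy
  have d_zero : ∀ {s t k}, g s = k → g t = k →
      (∀ u ∈ Set.Icc (min s t) (max s t), k ≤ g u) → d s t = 0 := by
    intro s t k hs ht hk
    refine ENNReal.ofReal_of_nonpos ((dOf_le_of_forall_le hk).trans ?_)
    linarith
  have dξ : ∀ r ∈ K, ∀ r' ∈ K, d (ξ r) (ξ r') ≤ ENNReal.ofReal |g (γ r) - g (γ r')| := by
    intro r hr r' hr'
    refine ENNReal.ofReal_le_ofReal ((dOf_le_of_forall_le (k := g c - max r r') ?_).trans ?_)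
    · intro u hu
      have huc : u ≤ c := hu.2.trans (max_le (hξ r hr).1.2 (hξ r' hr').1.2)
      rcases min_le_iff.1 hu.1 with hu1 | hu1
      · linarith [(hξ r hr).2.2 u ⟨hu1, huc⟩, le_max_left r r']
      · linarith [(hξ r' hr').2.2 u ⟨hu1, huc⟩, le_max_right r r']
    · rw [(hξ r hr).2.1, (hξ r' hr').2.1, (hγ r hr).2.1, (hγ r' hr').2.1]
      rcases le_total r r' with h | h
      · rw [max_eq_right h]; linarith [le_abs_self (g c - r - (g c - r'))]
      · rw [max_eq_left h]; linarith [neg_abs_le (g c - r - (g c - r'))]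
  have dγ : ∀ r ∈ K, ∀ r' ∈ K, d (γ r) (γ r') ≤ ENNReal.ofReal |g (ξ r) - g (ξ r')| := by
    intro r hr r' hr'
    refine ENNReal.ofReal_le_ofReal ((dOf_le_of_forall_le (k := g c - max r r') ?_).trans ?_)
    · intro u hu
      have huc : c ≤ u := (le_min (hγ r hr).1.1 (hγ r' hr').1.1).trans hu.1
      rcases le_max_iff.1 hu.2 with hu1 | hu1
      · linarith [(hγ r hr).2.2 u ⟨huc, hu1⟩, le_max_left r r']
      · linarith [(hγ r' hr').2.2 u ⟨huc, hu1⟩, le_max_right r r']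
    · rw [(hξ r hr).2.1, (hξ r' hr').2.1, (hγ r hr).2.1, (hγ r' hr').2.1]
      rcases le_total r r' with h | h
      · rw [max_eq_right h]; linarith [le_abs_self (g c - r - (g c - r'))]
      · rw [max_eq_left h]; linarith [neg_abs_le (g c - r - (g c - r'))]
  have isoA : ∀ r ∈ K, ∀ r' ∈ K, quotDistOn d R (Set.Icc a c) (ξ r) (ξ r') ≤
      quotDistOn d R (Set.Icc c b) (γ r) (γ r') := fun r hr r' hr' =>
    (quotDistOn_le (hξ r hr).1 (hξ r' hr').1).trans <| (dξ r hr r' hr').trans <|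
      ofReal_abs_sub_le_Dquot hgB (fun s hs t ht => hfg s (hB hs) t (hB ht)) _
  have isoB : ∀ r ∈ K, ∀ r' ∈ K, quotDistOn d R (Set.Icc c b) (γ r) (γ r') ≤
      quotDistOn d R (Set.Icc a c) (ξ r) (ξ r') := fun r hr r' hr' =>
    (quotDistOn_le (hγ r hr).1 (hγ r' hr').1).trans <| (dγ r hr r' hr').trans <|
      ofReal_abs_sub_le_Dquot hgA (fun s hs t ht => hfg s (hA hs) t (hA ht)) _
  have cross : ∀ x ∈ Set.Icc a c, ∀ y ∈ Set.Icc c b,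
      ∃ r ∈ K, d x (ξ r) + d (γ r) y ≤ d x y := by
    intro x hx y hy
    have hxy : x ≤ y := hx.2.trans hy.1
    obtain ⟨m, hm⟩ : ∃ m, m = sInf (g '' Set.Icc x y) := ⟨_, rfl⟩
    have hmle : ∀ u ∈ Set.Icc x y, m ≤ g u := fun u hu =>
      hm ▸ sInf_image_Icc_le (hg.mono (Set.Icc_subset_Icc hx.1 hy.2)) hu
    have hdxy : dOf g x y = g x + g y - 2 * m := by
      rw [dOf, min_eq_left hxy, max_eq_right hxy, hm]
    obtain ⟨v, hv⟩ : ∃ v, v = max m (max m₁ m₂) := ⟨_, rfl⟩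
    have hmv : m ≤ v := hv ▸ le_max_left _ _
    have hvc : v ≤ g c := hv ▸ max_le (hmle c ⟨hx.2, hy.1⟩) (sub_nonneg.1 h0K.2)
    have hr : g c - v ∈ K := ⟨sub_nonneg.2 hvc, sub_le_sub_left (hv ▸ le_max_right _ _) _⟩
    obtain ⟨hp, hgp, hpv⟩ := hξ _ hr
    obtain ⟨hq, hgq, hqv⟩ := hγ _ hr
    rw [sub_sub_cancel] at hgp hpv hgq hqv
    refine ⟨_, hr, ?_⟩
    have lowA : ∀ u ∈ Set.Icc (min x (ξ (g c - v))) (max x (ξ (g c - v))), m ≤ g u := by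
      intro u hu
      have huc : u ≤ c := hu.2.trans (max_le hx.2 hp.2)
      rcases min_le_iff.1 hu.1 with hu1 | hu1
      · exact hmle u ⟨hu1, huc.trans hy.1⟩
      · exact hmv.trans (hpv u ⟨hu1, huc⟩)
    have lowB : ∀ u ∈ Set.Icc (min (γ (g c - v)) y) (max (γ (g c - v)) y), m ≤ g u := by
      intro u hu
      have huc : c ≤ u := (le_min hq.1 hy.1).trans hu.1
      rcases le_max_iff.1 hu.2 with hu1 | hu1
      · exact hmv.trans (hqv u ⟨huc, hu1⟩)
      · exact hmle u ⟨hx.2.trans huc, hu1⟩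
    have nonnegA := (abs_nonneg _).trans (abs_sub_le_dOf hgA hx hp)
    have nonnegB := (abs_nonneg _).trans (abs_sub_le_dOf hgB hq hy)
    simp only [hddef]
    rw [← ENNReal.ofReal_add nonnegA nonnegB, hdxy]
    refine ENNReal.ofReal_le_ofReal ?_
    have h1 := dOf_le_of_forall_le lowA
    have h2 := dOf_le_of_forall_le lowB
    have h3 : v = m ∨ v = m₁ ∨ v = m₂ := by
      rcases max_choice m (max m₁ m₂) with h | h
      · exact Or.inl (hv.trans h)
      · rcases max_choice m₁ m₂ with h' | h'
        · exact Or.inr (Or.inl (hv.trans (h.trans h')))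
        · exact Or.inr (Or.inr (hv.trans (h.trans h')))
    rcases h3 with h3 | h3 | h3
    · linarith
    · have h4 : dOf g x (ξ (g c - v)) ≤ _ := dOf_le_of_forall_le (k := v) fun u hu =>
        h3 ▸ hm₁le u ⟨(le_min hx.1 hp.1).trans hu.1, hu.2.trans (max_le hx.2 hp.2)⟩
      linarith
    · have h4 : dOf g (γ (g c - v)) y ≤ _ := dOf_le_of_forall_le (k := v) fun u hu =>
        h3 ▸ hm₂le u ⟨(le_min hq.1 hy.1).trans hu.1, hu.2.trans (max_le hq.2 hy.2)⟩
      linarith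
  have rel : ∀ x ∈ Set.Icc a c, ∀ y ∈ Set.Icc c b, R x y → ∃ r ∈ K,
      quotDistOn d R (Set.Icc a c) x (ξ r) = 0 ∧
        quotDistOn d R (Set.Icc c b) (γ r) y = 0 := by
    intro x hx y hy hxy
    obtain rfl : x = c := by
      by_contra hne
      have hlt := lt_of_le_of_ne hx.2 hne
      have h1 := hfc x (hA hx) hlt
      have h2 := sInf_image_le_of_mem hf (hA hx) (hB hy) (u := c)
        ⟨(min_le_left _ _).trans hx.2, hy.1.trans (le_max_right _ _)⟩
      have h3 := sInf_image_le_of_mem hf (hA hx) (hB hy) (u := y)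
        ⟨min_le_right _ _, le_max_right _ _⟩
      simp only [hRdef, dOf] at hxy
      linarith
    obtain ⟨hp, hgp, hpv⟩ := hξ 0 h0K
    obtain ⟨hq, hgq, hqv⟩ := hγ 0 h0K
    rw [sub_zero] at hgp hpv hgq hqv
    refine ⟨0, h0K, le_antisymm ((quotDistOn_le hx hp).trans_eq ?_) bot_le, ?_⟩
    · refine d_zero rfl hgp fun u hu => hpv u ?_
      rwa [min_eq_right hp.2, max_eq_left hp.2] at hu
    · refine le_antisymm ((quotDistOn_le_of_rel hd hy hxy).trans
        ((quotDistOn_le hq ⟨le_rfl, hcb⟩).trans_eq ?_)) bot_le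
      refine d_zero hgq rfl fun u hu => hqv u ?_
      rwa [min_eq_right hq.1, max_eq_left hq.1] at hu
  have union : Set.Icc a c ∪ Set.Icc c b = Set.Icc a b := Set.Icc_union_Icc_eq_Icc hac hcb
  have glueA := fun s hs t => le_quotDistOn_union hd hds hR hRs (fun r hr => (hξ r hr).1)
    (fun r hr => (hγ r hr).1) isoA cross rel (s := s) hs t
  have glueB := fun s hs t => le_quotDistOn_union hd hds hR hRs (fun r hr => (hγ r hr).1)
    (fun r hr => (hξ r hr).1) isoB
    (fun x hx y hy => by
      obtain ⟨r, hr, h⟩ := cross y hy x hx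
      refine ⟨r, hr, ?_⟩
      rwa [add_comm, hds x, hds _ y, hds x])
    (fun x hx y hy hxy => by
      obtain ⟨r, hr, h1, h2⟩ := rel y hy x hx (hRs _ _ hxy)
      refine ⟨r, hr, ?_, ?_⟩
      · rwa [quotDistOn_comm hd hds hR hRs hx (hγ r hr).1]
      · rwa [quotDistOn_comm hd hds hR hRs (hξ r hr).1 hy]) (s := s) hs t
  rw [Set.union_comm] at glueB
  rw [union] at glueA glueB
  refine ⟨fun s hs t ht => le_antisymm (quotDistOn_anti hA _ _) ((glueA s hs t).1 ht),
    fun s hs t ht => le_antisymm (quotDistOn_anti hB _ _) ((glueB s hs t).1 ht),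
    fun s hs t ht => le_antisymm (le_iInf₂ fun r hr => ?_) ((glueA s hs t).2 ht)⟩
  obtain ⟨hp, hgp, hpv⟩ := hξ r hr
  obtain ⟨hq, hgq, hqv⟩ := hγ r hr
  have hpq : ξ r ≤ γ r := hp.2.trans hq.1
  have hzero : d (ξ r) (γ r) = 0 := by
    refine d_zero hgp hgq fun u hu => ?_
    rw [min_eq_left hpq, max_eq_right hpq] at hu
    rcases le_total u c with huc | huc
    · exact hpv u ⟨hu.1, huc⟩
    · exact hqv u ⟨huc, hu.2⟩
  calc quotDistOn d R (Set.Icc a b) s t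
      ≤ quotDistOn d R (Set.Icc a b) s (γ r) + quotDistOn d R (Set.Icc a b) (γ r) t :=
        quotDistOn_triangle hd hR _ _ _
    _ ≤ quotDistOn d R (Set.Icc a b) s (ξ r) + quotDistOn d R (Set.Icc a b) (γ r) t := by
        gcongr
        simpa [hzero] using
          quotDistOn_append (d := d) (R := R) (s := s) (hA hp) (hB hq) (hR (ξ r))
    _ ≤ quotDistOn d R (Set.Icc a c) s (ξ r) + quotDistOn d R (Set.Icc c b) (γ r) t :=
        add_le_add (quotDistOn_anti hA _ _) (quotDistOn_anti hB _ _)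

/-- the slice coded by `(f,g)` between levels `L` and `L''` is the metric
gluing of the slices between levels `L, L'` and `L', L''`, the shuttle of the first being
glued to the maximal geodesic of the second. -/
theorem slice_gluing
    (I : Set ℝ) (f g : ℝ → ℝ) (h : IsSliceTrajectory I f g)
    (L L' L'' : ℝ) (hLL' : L < L') (hL'L'' : L' < L'')
    (hlow : ∀ _ : BddBelow I, -f (sInf I) ≤ L)
    (hup : (⨅ t ∈ I, (f t : EReal)) ≤ ((-L'' : ℝ) : EReal))
    (hTL : {t | t ∈ I ∧ f t = -L}.Nonempty)
    (hTL'' : {t | t ∈ I ∧ f t = -L''}.Nonempty) :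
    (∀ s ∈ Set.Icc (hitT I f L) (hitT I f L'), ∀ t ∈ Set.Icc (hitT I f L) (hitT I f L'),
      Dquot f g (Set.Icc (hitT I f L) (hitT I f L'')) s t =
        Dquot f g (Set.Icc (hitT I f L) (hitT I f L')) s t) ∧
    (∀ s ∈ Set.Icc (hitT I f L') (hitT I f L''), ∀ t ∈ Set.Icc (hitT I f L') (hitT I f L''),
      Dquot f g (Set.Icc (hitT I f L) (hitT I f L'')) s t =
        Dquot f g (Set.Icc (hitT I f L') (hitT I f L'')) s t) ∧
    (∀ s ∈ Set.Icc (hitT I f L) (hitT I f L'), ∀ t ∈ Set.Icc (hitT I f L') (hitT I f L''),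
      Dquot f g (Set.Icc (hitT I f L) (hitT I f L'')) s t =
        ⨅ r ∈ Set.Icc (0:ℝ) (g (hitT I f L') -
          max (sInf (g '' Set.Icc (hitT I f L) (hitT I f L')))
              (sInf (g '' Set.Icc (hitT I f L') (hitT I f L'')))),
          (Dquot f g (Set.Icc (hitT I f L) (hitT I f L')) s
              (sSup {u | u ∈ Set.Icc (hitT I f L) (hitT I f L') ∧
                g u = g (hitT I f L') - r}) +
           Dquot f g (Set.Icc (hitT I f L') (hitT I f L''))
              (sInf {u | u ∈ Set.Icc (hitT I f L') (hitT I f L'') ∧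
                g u = g (hitT I f L') - r}) t)) := by
  
  obtain ⟨haI, hfa, ha⟩ := hitT_spec h hlow hTL
  obtain ⟨hbI, hfb, -⟩ :=
    hitT_spec h (fun hI => (hlow hI).trans (hLL'.trans hL'L'').le) hTL''
  have hord := h.2.1
  have hf := h.2.2.2.1
  have hab : hitT I f L ≤ hitT I f L'' := by
    by_contra! hlt
    linarith [ha _ hbI hlt]
  have hTL' : {t | t ∈ I ∧ f t = -L'}.Nonempty := by
    obtain ⟨u, hu, hfu⟩ := intermediate_value_Icc' hab (hf.mono (hord.out haI hbI))
      (show -L' ∈ Set.Icc _ _ from ⟨by linarith, by linarith⟩)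
    exact ⟨u, hord.out haI hbI hu, hfu⟩
  obtain ⟨hcI, hfc, hc⟩ := hitT_spec h (fun hI => (hlow hI).trans hLL'.le) hTL'
  have hac : hitT I f L ≤ hitT I f L' := by
    by_contra! hlt
    linarith [ha _ hcI hlt]
  have hcb : hitT I f L' ≤ hitT I f L'' := by
    by_contra! hlt
    linarith [hc _ hbI hlt]
  have hJ := hord.out haI hbI
  exact Dquot_gluing hac hcb (hf.mono hJ) (h.2.2.2.2.1.mono hJ)
    (fun s hs t ht => h.2.2.2.2.2.1 s (hJ hs) t (hJ ht))
    (fun t ht hlt => hfc ▸ hc t (hJ ht) hlt)
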